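/- Let t ≥ 1 be an integer and let h'_1,...,h'_t : X → {-1,1} be functions. Let σ_1,...,σ_t be independent uniform random signs in {-1,1}, let t' = |{i : σ_i = 1}|, and on the event t' > 0 define g(x) = (1/t') Σ_{i : σ_i = 1} h'_i(x). Then for any fixed point x and any μ ≥ 1/t, the probability that |g(x)| ≤ μ (with t' > 0) is at most 2μ√t. -/

import Mathlib

open Finset

lemma aux_wallis (n : ℕ) : Real.Wallis.W n * ((2*n+1) * ((n.centralBinom : ℝ))^2) = (4^n)^2 := by
  induction n with
  | zero => simp [Real.Wallis.W]
  | succ k ih =>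
    have h : ((k:ℝ)+1) * ((k+1).centralBinom : ℝ) = 2 * (2*k+1) * (k.centralBinom : ℝ) := by
      exact_mod_cast Nat.succ_mul_centralBinom_succ k
    have hk : (0:ℝ) < k + 1 := by positivity
    have h2 : ((k+1).centralBinom : ℝ) = 2 * (2*k+1) * (k.centralBinom : ℝ) / (k+1) := by
      field_simp; linarith
    rw [Real.Wallis.W_succ, h2, pow_succ 4 k, mul_pow _ _ 2, ← ih]
    push_cast
    field_simp
    ring

lemma aux_even (n : ℕ) : (n.centralBinom : ℝ) * Real.sqrt (2*n) * 5 ≤ 4 * 4^n := by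
  have h1 := aux_wallis n
  have h2 := Real.Wallis.le_W n
  have hpi := Real.pi_gt_d2
  have hn : (0:ℝ) ≤ n := by positivity
  set C : ℝ := (n.centralBinom : ℝ)
  have h3 : (2*(n:ℝ)+1)/(2*n+2) * (3.125/2) ≤ Real.Wallis.W n := by
    refine le_trans ?_ h2
    gcongr
    linarith
  have h4 : (2*(n:ℝ)+1)/(2*n+2) * (3.125/2) * ((2*n+1) * C^2) ≤ (4^n)^2 := by
    rw [← h1]; gcongr
  have h5 : 2 * n * C^2 * 25 ≤ 16 * (4^n)^2 := by
    refine le_trans ?_ (mul_le_mul_of_nonneg_left h4 (by norm_num))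
    have : (2*(n:ℝ)) ≤ (2*n+1)/(2*n+2) * (2*n+1) := by
      rw [div_mul_eq_mul_div, le_div_iff₀ (by positivity)]; nlinarith
    have := mul_le_mul_of_nonneg_right this (sq_nonneg C)
    nlinarith
  apply le_of_sq_le_sq _ (by positivity)
  rw [mul_pow, mul_pow, Real.sq_sqrt (by positivity)]
  nlinarith

lemma aux_choose (t : ℕ) : (t.choose (t/2) : ℝ) * Real.sqrt t * 5 ≤ 4 * 2^t := by
  rcases Nat.even_or_odd' t with ⟨n, rfl | rfl⟩
  · have := aux_even n
    rw [Nat.centralBinom] at this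
    rw [Nat.mul_div_cancel_left _ (by norm_num), pow_mul]
    push_cast
    norm_num at this ⊢
    exact this
  · have h := aux_even (n+1)
    have e : (n+1).centralBinom = 2 * (2*n+1).choose n := by
      rw [Nat.centralBinom, show 2*(n+1) = (2*n+1)+1 by ring, Nat.choose_succ_succ,
        Nat.choose_symm_half]; ring
    rw [e] at h
    rw [show (2*n+1)/2 = n by omega]
    have hs : Real.sqrt ((2*n+1 : ℕ):ℝ) ≤ Real.sqrt (2*((n+1:ℕ):ℝ)) := by
      apply Real.sqrt_le_sqrt; push_cast; linarith
    have h2 := mul_le_mul_of_nonneg_left hs (Nat.cast_nonneg (α := ℝ) ((2*n+1).choose n))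
    have e2 : (2:ℝ)^(2*n+1) = 2 * 4^n := by rw [pow_succ, pow_mul]; norm_num; ring
    rw [e2]
    rw [pow_succ] at h
    push_cast at h h2 ⊢
    nlinarith

lemma aux_cheb (t : ℕ) (ht : 1 ≤ t) :
    ((univ.filter (fun A : Finset (Fin t) => 5 * t ≤ 6 * #A)).card : ℝ) * (4 * t) ≤ 9 * 2^t := by
  have hv := congrArg (Polynomial.eval (1/2 : ℝ)) (bernsteinPolynomial.variance ℝ t)
  have hb : ∀ k ∈ range (t+1), Polynomial.eval (1/2:ℝ) (bernsteinPolynomial ℝ t k) = t.choose k * (1/2)^t := by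
    intro k hk
    have : k ≤ t := by simpa [Nat.lt_succ_iff] using hk
    rw [bernsteinPolynomial]
    simp only [Polynomial.eval_mul, Polynomial.eval_pow, Polynomial.eval_sub, Polynomial.eval_X, Polynomial.eval_one, Polynomial.eval_natCast]
    rw [mul_assoc, show (1 - 1/2:ℝ) = 1/2 by norm_num, ← pow_add]
    congr 2; omega
  have hs : ∑ A : Finset (Fin t), ((t:ℝ)/2 - #A)^2 = (2:ℝ)^t * t / 4 := by
    rw [← Finset.powerset_univ, Finset.sum_powerset_apply_card (fun k => ((t:ℝ)/2 - k)^2)]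
    simp only [Polynomial.eval_finsetSum, Polynomial.eval_mul, Polynomial.eval_pow, Polynomial.eval_sub, Polynomial.eval_smul, Polynomial.eval_X, Polynomial.eval_one, Polynomial.eval_natCast] at hv
    rw [Finset.sum_congr rfl (fun k hk => by rw [hb k hk])] at hv
    have e : ∑ k ∈ range (t+1), (t.choose k : ℝ) * ((t:ℝ)/2 - k)^2 = (2:ℝ)^t * ((t:ℝ) * (1/2) * (1-1/2)) := by
      simp only [nsmul_eq_mul, smul_eq_mul] at hv
      rw [← hv, Finset.mul_sum]
      apply Finset.sum_congr rfl
      intro k _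
      have : (2:ℝ)^t * (1/2)^t = 1 := by rw [← mul_pow]; norm_num
      linear_combination (-(t.choose k : ℝ) * ((t:ℝ)/2 - k)^2) * this
    simp only [card_univ, Fintype.card_fin, nsmul_eq_mul]
    rw [e]; ring
  have h2 : ((univ.filter (fun A : Finset (Fin t) => 5 * t ≤ 6 * #A)).card : ℝ) * ((t:ℝ)/3)^2 ≤ 2^t * t / 4 := by
    rw [← hs, ← nsmul_eq_mul, ← Finset.sum_const]
    refine le_trans (Finset.sum_le_sum ?_) (Finset.sum_le_sum_of_subset_of_nonneg (Finset.filter_subset _ _) (fun _ _ _ => sq_nonneg _))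
    intro A hA
    have : 5 * t ≤ 6 * #A := by simpa using hA
    have : 5 * (t:ℝ) ≤ 6 * #A := by exact_mod_cast this
    have ht0 : (0:ℝ) ≤ t := by positivity
    nlinarith
  have ht0 : (0:ℝ) < t := by exact_mod_cast ht
  refine le_of_mul_le_mul_right ?_ ht0
  nlinarith

lemma aux_sum {t : ℕ} (h : Fin t → ℝ) (hv : ∀ i, h i = 1 ∨ h i = -1) (A : Finset (Fin t)) :
    ∑ i ∈ A, h i = ((#(symmDiff A (univ.filter (fun i => h i = -1))) : ℤ) - (#(univ.filter (fun i => h i = -1)) : ℤ) : ℤ) := by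
  push_cast
  rw [Finset.card_eq_sum_ones, Finset.card_eq_sum_ones]
  push_cast
  rw [eq_sub_iff_add_eq]
  have e : ∀ B : Finset (Fin t), ∀ f : Fin t → ℝ, ∑ i ∈ B, f i = ∑ i, if i ∈ B then f i else 0 := by
    intro B f; simp
  rw [e A, e (filter _ _), e (symmDiff _ _), ← Finset.sum_add_distrib]
  apply Finset.sum_congr rfl
  intro i _
  rcases hv i with hi | hi <;> by_cases hA : i ∈ A <;> simp [hi, hA, Finset.mem_symmDiff] <;> norm_num

lemma aux_point {t : ℕ} (B : Finset (Fin t)) (k : ℤ) :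
    (univ.filter (fun A : Finset (Fin t) => (#(symmDiff A B) : ℤ) - #B = k)).card ≤ t.choose (t/2) := by
  have h1 : (univ.filter (fun A : Finset (Fin t) => (#(symmDiff A B) : ℤ) - #B = k)).card
      ≤ (powersetCard (k + #B).toNat (univ : Finset (Fin t))).card := by
    apply Finset.card_le_card_of_injOn (fun A => symmDiff A B)
    · intro A hA
      simp at hA ⊢
      omega
    · intro A _ A' _ hh
      exact symmDiff_left_injective B hh
  refine h1.trans ?_
  rw [card_powersetCard, card_univ, Fintype.card_fin]
  exact Nat.choose_le_middle _ _

theorem stmt_0 {X : Type*} (t : ℕ) (ht : 1 ≤ t) (h' : Fin t → X → ℝ)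
    (hval : ∀ i x, h' i x = 1 ∨ h' i x = -1) (x : X) (μ : ℝ) (hμ : 1 / (t : ℝ) ≤ μ) :
    ((Finset.univ.filter (fun σ : Fin t → Bool =>
        0 < (Finset.univ.filter (fun i => σ i = true)).card ∧
        |((Finset.univ.filter (fun i => σ i = true)).card : ℝ)⁻¹ *
          ∑ i ∈ Finset.univ.filter (fun i => σ i = true), h' i x| ≤ μ)).card : ℝ)
      / 2 ^ t ≤ 2 * μ * Real.sqrt t := by
  set B : Finset (Fin t) := univ.filter (fun i => h' i x = -1) with hB
  set z : Finset (Fin t) → ℤ := fun A => (#(symmDiff A B) : ℤ) - #B with hz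
  have hsum : ∀ A, ∑ i ∈ A, h' i x = (z A : ℝ) := fun A => aux_sum (fun i => h' i x) (fun i => hval i x) A
  have ht0 : (0:ℝ) < t := by exact_mod_cast ht
  set s : ℝ := μ * t with hs
  have hs1 : 1 ≤ s := by rwa [div_le_iff₀ ht0] at hμ
  have hq : 0 < Real.sqrt t := Real.sqrt_pos.2 ht0
  have hqq : Real.sqrt t * Real.sqrt t = t := Real.mul_self_sqrt ht0.le
  have hrhs : 2 * μ * Real.sqrt t * Real.sqrt t = 2 * s := by rw [mul_assoc, hqq, hs]; ring
  have h2t : (0:ℝ) < 2^t := by positivity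
  set E := Finset.univ.filter (fun σ : Fin t → Bool =>
        0 < (Finset.univ.filter (fun i => σ i = true)).card ∧
        |((Finset.univ.filter (fun i => σ i = true)).card : ℝ)⁻¹ *
          ∑ i ∈ Finset.univ.filter (fun i => σ i = true), h' i x| ≤ μ) with hE
  rw [div_le_iff₀ h2t]
  refine le_of_mul_le_mul_right ?_ hq
  have hgoal : 2 * μ * Real.sqrt t * 2^t * Real.sqrt t = 2 * s * 2^t := by rw [← hrhs]; ring
  rw [hgoal]
  set F := univ.filter (fun A : Finset (Fin t) => |(z A : ℝ)| ≤ μ * #A) with hF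
  have hEF : E.card ≤ F.card := by
    apply Finset.card_le_card_of_injOn (fun σ => univ.filter (fun i => σ i = true))
    · intro σ hσ
      rw [hE, Finset.mem_coe, Finset.mem_filter] at hσ
      obtain ⟨_, hp, hle⟩ := hσ
      rw [hF, Finset.mem_coe, Finset.mem_filter]
      refine ⟨mem_univ _, ?_⟩
      have hp' : (0:ℝ) < #(univ.filter (fun i => σ i = true)) := by exact_mod_cast hp
      rw [hsum, abs_mul, abs_of_pos (inv_pos.2 hp'), inv_mul_le_iff₀ hp'] at hle
      linarith
    · intro σ _ τ _ hh
      funext i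
      have := Finset.ext_iff.1 hh i
      simp at this
      exact this
  have hEF' : (E.card : ℝ) ≤ F.card := by exact_mod_cast hEF
  refine le_trans (mul_le_mul_of_nonneg_right hEF' hq.le) ?_
  have hC := aux_choose t
  set C : ℝ := (t.choose (t/2) : ℝ)
  have hμ0 : 0 ≤ μ := le_trans (by positivity) hμ
  have hcard : ∀ A : Finset (Fin t), (#A : ℝ) ≤ t := by
    intro A
    exact_mod_cast (Finset.card_le_univ A).trans (by simp)
  by_cases hcase : 1.2 ≤ s
  · -- union bound
    set r := ⌊s⌋₊ with hr
    have hrs : (r:ℝ) ≤ s := Nat.floor_le (by linarith)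
    have hr1 : 1 ≤ r := Nat.le_floor (by exact_mod_cast hs1)
    have hsub : F ⊆ (Icc (-(r:ℤ)) r).biUnion (fun k => univ.filter (fun A => z A = k)) := by
      intro A hA
      have hA' : |(z A : ℝ)| ≤ μ * #A := by simpa [hF] using hA
      have h3 : |(z A : ℝ)| ≤ s := hA'.trans (mul_le_mul_of_nonneg_left (hcard A) hμ0)
      have h4 : (z A).natAbs ≤ r := by
        apply Nat.le_floor
        rw [Nat.cast_natAbs]; exact_mod_cast h3
      simp only [mem_biUnion, mem_filter, mem_univ, true_and, exists_eq_right', mem_Icc]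
      omega
    have hFc : F.card ≤ (2*r+1) * t.choose (t/2) := by
      refine (card_le_card hsub).trans ?_
      refine (card_biUnion_le_card_mul _ _ _ (fun k _ => aux_point B k)).trans ?_
      apply Nat.mul_le_mul_right
      simp; omega
    have hFc' : (F.card:ℝ) ≤ (2*r+1) * C := by
      have := (Nat.cast_le (α := ℝ)).2 hFc
      push_cast at this; exact this
    have h5 := mul_le_mul_of_nonneg_right hFc' hq.le
    have h6 : (2*(r:ℝ)+1) * 4 ≤ 10 * s := by
      rcases Nat.lt_or_ge r 2 with h | h
      · have : r = 1 := by omega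
        rw [this]; norm_num at hcase ⊢; linarith
      · have : (2:ℝ) ≤ r := by exact_mod_cast h
        linarith
    have h7 := mul_le_mul_of_nonneg_left hC (show (0:ℝ) ≤ 2*r+1 by positivity)
    have h8 := mul_le_mul_of_nonneg_right h6 h2t.le
    nlinarith
  · push Not at hcase
    by_cases ht4 : t < 4
    · have h1 : F.card ≤ 2^t := by
        refine (Finset.card_le_univ F).trans ?_
        simp
      have h1' : (F.card:ℝ) ≤ 2^t := by exact_mod_cast h1
      have h2 : Real.sqrt t ≤ 2 := by
        rw [Real.sqrt_le_left (by norm_num)]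
        have : (t:ℝ) < 4 := by exact_mod_cast ht4
        linarith
      have := mul_le_mul h1' h2 hq.le h2t.le
      nlinarith
    · have hch := aux_cheb t ht
      set G := univ.filter (fun A : Finset (Fin t) => 5 * t ≤ 6 * #A)
      have hsub : F ⊆ univ.filter (fun A => z A = 0) ∪ G := by
        intro A hA
        have hA' : |(z A : ℝ)| ≤ μ * #A := by simpa [hF] using hA
        rw [mem_union]
        by_cases h0 : z A = 0
        · left; simp [h0]
        · right
          have h1 : (1:ℝ) ≤ |(z A : ℝ)| := by exact_mod_cast Int.one_le_abs h0
          have h2 : (t:ℝ) ≤ s * #A := by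
            have := mul_le_mul_of_nonneg_right (h1.trans hA') ht0.le
            rw [hs]; linarith
          have h3 : s * #A ≤ 1.2 * #A := by gcongr
          have : 5 * (t:ℝ) ≤ 6 * #A := by linarith
          simp only [G, mem_filter, mem_univ, true_and]
          exact_mod_cast this
      have hFc : F.card ≤ t.choose (t/2) + G.card :=
        (card_le_card hsub).trans ((card_union_le _ _).trans (Nat.add_le_add_right (aux_point B 0) _))
      have hFc' : (F.card:ℝ) ≤ C + G.card := by
        have := (Nat.cast_le (α := ℝ)).2 hFc
        push_cast at this; exact this
      have h2 : 2 ≤ Real.sqrt t := by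
        apply Real.le_sqrt_of_sq_le
        have : (4:ℝ) ≤ t := by exact_mod_cast (not_lt.1 ht4)
        linarith
      have h3 : (G.card:ℝ) * Real.sqrt t * 8 ≤ 9 * 2^t := by
        refine le_trans ?_ hch
        have h4 : Real.sqrt t * 2 ≤ t := by nlinarith
        have := mul_le_mul_of_nonneg_left h4 (Nat.cast_nonneg (α := ℝ) G.card)
        linarith
      have h5 := mul_le_mul_of_nonneg_right hFc' hq.le
      nlinarith
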